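/- arXiv:2011.03220 — 3 statements merged into one kernel-verified Lean document; each statement's English description precedes it below -/
import Mathlib

section
/- Let 1 < p < ∞ and n ≥ 1. If u : ℝⁿ → ℝ is smooth with u ∈ L^p(ℝⁿ) and Δu ∈ L^p(ℝⁿ), then there exists a sequence of smooth compactly supported functions φ_k : ℝⁿ → ℝ such that ‖φ_k − u‖_{L^p} → 0 and ‖Δφ_k − Δu‖_{L^p} → 0 as k → ∞; that is, C_c^∞ is dense in the space W̃^{2,p} of L^p functions with L^p Laplacian (Milatovic's density theorem, specialized to Euclidean space). -/
open MeasureTheory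

/-- Partial derivative `∂ᵢ u` of a function on `ℝⁿ = EuclideanSpace ℝ (Fin n)`. -/
noncomputable def pd {n : ℕ} (u : EuclideanSpace ℝ (Fin n) → ℝ) (i : Fin n)
    (x : EuclideanSpace ℝ (Fin n)) : ℝ :=
  fderiv ℝ u x (EuclideanSpace.single i 1)

/-- Second partial derivative `∂ᵢ∂ⱼ u`. -/
noncomputable def pd2 {n : ℕ} (u : EuclideanSpace ℝ (Fin n) → ℝ) (i j : Fin n)
    (x : EuclideanSpace ℝ (Fin n)) : ℝ :=
  pd (pd u j) i x

/-- Laplacian `Δu = ∑ᵢ ∂ᵢ² u`. -/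
noncomputable def lap {n : ℕ} (u : EuclideanSpace ℝ (Fin n) → ℝ)
    (x : EuclideanSpace ℝ (Fin n)) : ℝ :=
  ∑ i : Fin n, pd2 u i i x

/-- Euclidean norm of the gradient, `|∇u|(x) = (∑ᵢ (∂ᵢu)²)^{1/2}`. -/
noncomputable def gradNorm {n : ℕ} (u : EuclideanSpace ℝ (Fin n) → ℝ)
    (x : EuclideanSpace ℝ (Fin n)) : ℝ :=
  Real.sqrt (∑ i : Fin n, pd u i x ^ 2)

/-- Hilbert–Schmidt norm of the Hessian, `|Hess u|(x) = (∑_{i,j} (∂ᵢ∂ⱼu)²)^{1/2}`. -/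
noncomputable def hessNorm {n : ℕ} (u : EuclideanSpace ℝ (Fin n) → ℝ)
    (x : EuclideanSpace ℝ (Fin n)) : ℝ :=
  Real.sqrt (∑ i : Fin n, ∑ j : Fin n, pd2 u i j x ^ 2)

/-- `L^p` norm with respect to Lebesgue measure on `ℝⁿ`:  `(∫ |f|^p)^{1/p}`. -/
noncomputable def lpNorm {n : ℕ} (p : ℝ) (f : EuclideanSpace ℝ (Fin n) → ℝ) : ℝ :=
  (∫ x, |f x| ^ p) ^ (1 / p)

open scoped ENNReal Convolution

section aux

lemma young_lintegral {n : ℕ} {p : ℝ} (hp : 1 < p)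
    {F G : EuclideanSpace ℝ (Fin n) → ℝ≥0∞} (hF : Measurable F) (hG : Measurable G) :
    ∫⁻ x, (∫⁻ t, F t * G (x - t)) ^ p ≤ (∫⁻ t, G t) ^ p * ∫⁻ t, F t ^ p := by
  have hpq := Real.HolderConjugate.conjExponent hp
  set q := p.conjExponent with hq
  have hp0 : 0 < p := by linarith
  have hq0 : 0 < q := hpq.symm.pos
  set W := ∫⁻ t, G t with hW
  have h1 : ∀ x, (∫⁻ t, F t * G (x - t)) ^ p ≤ (∫⁻ t, F t ^ p * G (x - t)) * W ^ (p - 1) := by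
    intro x
    have hGx : Measurable fun t => G (x - t) := hG.comp (measurable_const.sub measurable_id)
    have := ENNReal.lintegral_mul_le_Lp_mul_Lq volume hpq
      (f := fun t => F t * G (x - t) ^ (1 / p)) (g := fun t => G (x - t) ^ (1 / q))
      (hF.mul (hGx.pow_const _)).aemeasurable (hGx.pow_const _).aemeasurable
    have e1 : ∀ t, ((fun t => F t * G (x - t) ^ (1 / p)) * (fun t => G (x - t) ^ (1 / q))) t
        = F t * G (x - t) := by
      intro t
      simp only [Pi.mul_apply]
      rw [mul_assoc, ← ENNReal.rpow_add_of_nonneg _ _ (by positivity) (by positivity)]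
      have : 1 / p + 1 / q = 1 := by simpa using hpq.inv_add_inv_eq_one
      rw [this, ENNReal.rpow_one]
    have e2 : ∀ t, (F t * G (x - t) ^ (1 / p)) ^ p = F t ^ p * G (x - t) := by
      intro t
      rw [ENNReal.mul_rpow_of_nonneg _ _ hp0.le, ← ENNReal.rpow_mul, one_div_mul_cancel hp0.ne',
        ENNReal.rpow_one]
    have e3 : ∀ t, (G (x - t) ^ (1 / q)) ^ q = G (x - t) := by
      intro t
      rw [← ENNReal.rpow_mul, one_div_mul_cancel hq0.ne', ENNReal.rpow_one]
    simp only [e1, e2, e3] at this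
    rw [lintegral_sub_left_eq_self (fun t => G t) x] at this
    calc _ ≤ _ := ENNReal.rpow_le_rpow this hp0.le
      _ = _ := by
        rw [ENNReal.mul_rpow_of_nonneg _ _ hp0.le, ← ENNReal.rpow_mul, ← ENNReal.rpow_mul,
          one_div_mul_cancel hp0.ne', ENNReal.rpow_one]
        congr 2
        have := hpq.inv_add_inv_eq_one
        field_simp at this ⊢
        linarith
  have hm : Measurable (Function.uncurry fun x t : EuclideanSpace ℝ (Fin n) =>
      F t ^ p * G (x - t)) :=
    ((hF.comp measurable_snd).pow_const _).mul (hG.comp (measurable_fst.sub measurable_snd))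
  calc _ ≤ ∫⁻ x, (∫⁻ t, F t ^ p * G (x - t)) * W ^ (p - 1) := lintegral_mono h1
    _ = (∫⁻ x, ∫⁻ t, F t ^ p * G (x - t)) * W ^ (p - 1) :=
        lintegral_mul_const _ hm.lintegral_prod_right
    _ = (∫⁻ t, ∫⁻ x, F t ^ p * G (x - t)) * W ^ (p - 1) := by
        rw [lintegral_lintegral_swap hm.aemeasurable]
    _ = (∫⁻ t, F t ^ p * W) * W ^ (p - 1) := by
        congr 2
        ext t
        have hGt : Measurable fun x => G (x - t) := hG.comp (measurable_id.sub measurable_const)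
        rw [lintegral_const_mul _ hGt,
          lintegral_sub_right_eq_self (fun t => G t) t]
    _ = (∫⁻ t, F t ^ p) * (W ^ (1:ℝ) * W ^ (p - 1)) := by
        rw [lintegral_mul_const _ (hF.pow_const _), mul_assoc, ENNReal.rpow_one]
    _ = _ := by
        rw [← ENNReal.rpow_add_of_nonneg _ _ (by norm_num) (by linarith), mul_comm]
        congr 2; ring

noncomputable abbrev cv {n : ℕ} (f g : EuclideanSpace ℝ (Fin n) → ℝ) : EuclideanSpace ℝ (Fin n) → ℝ :=
  f ⋆[ContinuousLinearMap.mul ℝ ℝ, volume] g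

lemma cv_apply {n : ℕ} (f g : EuclideanSpace ℝ (Fin n) → ℝ) (x) :
    cv f g x = ∫ t, f t * g (x - t) := rfl

lemma young {n : ℕ} {p : ℝ} (hp : 1 < p)
    {f g : EuclideanSpace ℝ (Fin n) → ℝ} (hf : Continuous f) (hg : Continuous g) :
    eLpNorm (cv f g) (ENNReal.ofReal p) volume
      ≤ (∫⁻ t, ‖g t‖ₑ) * eLpNorm f (ENNReal.ofReal p) volume := by
  have hp0 : 0 < p := by linarith
  have hP : ENNReal.ofReal p ≠ 0 := by simpa using hp0
  rw [eLpNorm_eq_lintegral_rpow_enorm_toReal hP (by simp),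
    eLpNorm_eq_lintegral_rpow_enorm_toReal hP (by simp), ENNReal.toReal_ofReal hp0.le]
  have h := young_lintegral hp (F := fun t => ‖f t‖ₑ) (G := fun t => ‖g t‖ₑ)
    (by fun_prop) (by fun_prop)
  have h2 : ∫⁻ x, ‖cv f g x‖ₑ ^ p ≤ (∫⁻ t, ‖g t‖ₑ) ^ p * ∫⁻ t, ‖f t‖ₑ ^ p := by
    refine le_trans (lintegral_mono fun x => ?_) h
    refine ENNReal.rpow_le_rpow ?_ hp0.le
    rw [cv_apply]
    refine (enorm_integral_le_lintegral_enorm _).trans (le_of_eq ?_)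
    simp only [enorm_mul]
  calc _ ≤ _ := ENNReal.rpow_le_rpow h2 (by positivity)
    _ = _ := by
      rw [ENNReal.mul_rpow_of_nonneg _ _ (by positivity), ← ENNReal.rpow_mul,
        mul_one_div_cancel hp0.ne', ENNReal.rpow_one]

lemma pd_contDiff {n : ℕ} {u : EuclideanSpace ℝ (Fin n) → ℝ} {m : ℕ∞}
    (hu : ContDiff ℝ ((m + 1 : ℕ∞)) u)
    (i : Fin n) : ContDiff ℝ m (pd u i) := by
  unfold pd
  exact (hu.fderiv_right (m := m) (by norm_cast)).clm_apply contDiff_const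

lemma pd_smooth {n : ℕ} {u : EuclideanSpace ℝ (Fin n) → ℝ} (hu : ContDiff ℝ (⊤ : ℕ∞) u)
    (i : Fin n) : ContDiff ℝ (⊤ : ℕ∞) (pd u i) :=
  pd_contDiff (by simpa using hu) i

lemma lap_smooth {n : ℕ} {u : EuclideanSpace ℝ (Fin n) → ℝ} (hu : ContDiff ℝ (⊤ : ℕ∞) u) :
    ContDiff ℝ (⊤ : ℕ∞) (lap u) := by
  unfold lap pd2
  exact ContDiff.sum fun i _ => pd_smooth (pd_smooth hu i) i

lemma pd_compact {n : ℕ} {u : EuclideanSpace ℝ (Fin n) → ℝ} (hu : HasCompactSupport u)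
    (i : Fin n) : HasCompactSupport (pd u i) :=
  hu.fderiv_apply ℝ _

lemma cv_smooth {n : ℕ} {u ρ : EuclideanSpace ℝ (Fin n) → ℝ} (hu : Continuous u)
    (hρ : ContDiff ℝ (⊤ : ℕ∞) ρ) (hc : HasCompactSupport ρ) : ContDiff ℝ (⊤ : ℕ∞) (cv u ρ) :=
  hc.contDiff_convolution_right _ hu.locallyIntegrable hρ

lemma pd_cv_right {n : ℕ} {u ρ : EuclideanSpace ℝ (Fin n) → ℝ} (hu : Continuous u)
    (hρ : ContDiff ℝ (⊤ : ℕ∞) ρ) (hc : HasCompactSupport ρ) (i : Fin n) :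
    pd (cv u ρ) i = cv u (pd ρ i) := by
  ext x
  have h1 : ContDiff ℝ 1 ρ := hρ.of_le (by norm_cast)
  have := hc.hasFDerivAt_convolution_right (ContinuousLinearMap.mul ℝ ℝ)
    (hu.locallyIntegrable (μ := volume)) h1 x
  rw [pd, this.fderiv, convolution_precompR_apply _ hu.locallyIntegrable (hc.fderiv ℝ)
    (h1.continuous_fderiv (by norm_num))]
  rfl

lemma pd_cv_left {n : ℕ} {u ρ : EuclideanSpace ℝ (Fin n) → ℝ} (hu : ContDiff ℝ (⊤ : ℕ∞) u)
    (hρ : ContDiff ℝ (⊤ : ℕ∞) ρ) (hc : HasCompactSupport ρ) (i : Fin n) :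
    pd (cv u ρ) i = cv (pd u i) ρ := by
  rw [pd_cv_right hu.continuous hρ hc]
  ext x
  rw [cv_apply, cv_apply]
  set g : EuclideanSpace ℝ (Fin n) → ℝ := fun t => ρ (x - t) with hg
  have hgs : ContDiff ℝ (⊤ : ℕ∞) g := hρ.comp (contDiff_const.sub contDiff_id)
  have hgc : HasCompactSupport g := hc.comp_homeomorph (Homeomorph.subLeft x)
  have hgd : ∀ t, pd g i t = - pd ρ i (x - t) := by
    intro t
    have hd : HasFDerivAt g ((fderiv ℝ ρ (x - t)).comp
        (-ContinuousLinearMap.id ℝ (EuclideanSpace ℝ (Fin n)))) t :=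
      ((hρ.differentiable (by simp)) (x - t)).hasFDerivAt.comp t
        ((hasFDerivAt_id t).const_sub x)
    rw [pd, hd.fderiv]
    simp [pd]
  have hpg := pd_compact hgc i
  have hib := integral_mul_fderiv_eq_neg_fderiv_mul_of_integrable (μ := volume) (f := u) (g := g)
    (v := EuclideanSpace.single i 1)
    (((pd_smooth hu i).continuous.mul hgs.continuous).integrable_of_hasCompactSupport hgc.mul_left)
    ((hu.continuous.mul (pd_smooth hgs i).continuous).integrable_of_hasCompactSupport hpg.mul_left)
    ((hu.continuous.mul hgs.continuous).integrable_of_hasCompactSupport hgc.mul_left)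
    (fun t _ => hu.differentiable (by simp) t) (fun t _ => hgs.differentiable (by simp) t)
  change ∫ t, u t * pd g i t = - ∫ t, pd u i t * g t at hib
  simp only [hgd, mul_neg, integral_neg, neg_inj] at hib
  exact hib

lemma cv_exists {n : ℕ} {u ρ : EuclideanSpace ℝ (Fin n) → ℝ} (hu : Continuous u)
    (hρ : Continuous ρ) (hc : HasCompactSupport ρ) (x : EuclideanSpace ℝ (Fin n)) :
    Integrable (fun t => u t * ρ (x - t)) :=
  hc.convolutionExists_right (ContinuousLinearMap.mul ℝ ℝ) (hu.locallyIntegrable (μ := volume))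
    hρ x

lemma lap_cv {n : ℕ} {u ρ : EuclideanSpace ℝ (Fin n) → ℝ} (hu : ContDiff ℝ (⊤ : ℕ∞) u)
    (hρ : ContDiff ℝ (⊤ : ℕ∞) ρ) (hc : HasCompactSupport ρ) :
    lap (cv u ρ) = cv (lap u) ρ := by
  ext x
  have : ∀ i, pd2 (cv u ρ) i i x = ∫ t, pd2 u i i t * ρ (x - t) := by
    intro i
    unfold pd2
    rw [pd_cv_left hu hρ hc, pd_cv_left (pd_smooth hu i) hρ hc]
    rfl
  simp only [lap, this, cv_apply, Finset.sum_mul]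
  rw [integral_finsetSum]
  intro i _
  exact cv_exists (pd_smooth (pd_smooth hu i) i).continuous hρ.continuous hc x

lemma cv_close {n : ℕ} {g ρ : EuclideanSpace ℝ (Fin n) → ℝ} {δ η : ℝ} (hη : 0 ≤ η)
    (hg : Continuous g) (hs : Function.support ρ ⊆ Metric.ball 0 δ) (hn : ∀ x, 0 ≤ ρ x)
    (hi : ∫ x, ρ x = 1) (x : EuclideanSpace ℝ (Fin n))
    (h : ∀ y ∈ Metric.ball x δ, dist (g y) (g x) ≤ η) : dist (cv g ρ x) (g x) ≤ η := by
  have := dist_convolution_le (μ := volume) hη hs hn hi hg.aestronglyMeasurable h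
  rw [convolution_lsmul_swap] at this
  rw [cv_apply]
  simpa [mul_comm] using this

lemma mollify {n : ℕ} {p : ℝ} (hp : 1 < p) {f : EuclideanSpace ℝ (Fin n) → ℝ}
    (hf : Continuous f) (hfp : MemLp f (ENNReal.ofReal p) volume) {ε : ℝ≥0∞} (hε : ε ≠ 0) :
    ∃ δ > 0, ∀ ρ : EuclideanSpace ℝ (Fin n) → ℝ, Continuous ρ → HasCompactSupport ρ →
      Function.support ρ ⊆ Metric.ball 0 δ → (∀ x, 0 ≤ ρ x) → ∫ x, ρ x = 1 →
      eLpNorm (cv f ρ - f) (ENNReal.ofReal p) volume ≤ ε := by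
  have hp0 : 0 < p := by linarith
  have hP : ENNReal.ofReal p ≠ 0 := by simpa using hp0
  have hP1 : 1 ≤ ENNReal.ofReal p := by simpa using hp.le
  have hε3 : ε / 3 ≠ 0 := (ENNReal.div_pos hε (by norm_num)).ne'
  obtain ⟨g, hgc, hfg, hg, -⟩ := hfp.exists_hasCompactSupport_eLpNorm_sub_le (by simp) hε3
  set K := Metric.cthickening 1 (tsupport g) with hK
  have hKc : IsCompact K := hgc.isCompact.cthickening
  have hV : volume K ^ (1 / p) ≠ ∞ := (ENNReal.rpow_lt_top_of_nonneg (by positivity)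
    hKc.measure_lt_top.ne).ne
  obtain ⟨η, hη0, hη⟩ := ENNReal.exists_nnreal_pos_mul_lt hV hε3
  obtain ⟨δ, hδ0, hδ⟩ := Metric.uniformContinuous_iff.1
    (hgc.uniformContinuous_of_continuous hg) η hη0
  refine ⟨min δ 1, by positivity, fun ρ hρ hρc hs hn hi => ?_⟩
  have hρint : ∫⁻ t, ‖ρ t‖ₑ = 1 := by
    have h1 := ofReal_integral_eq_lintegral_ofReal (μ := volume)
      (hρ.integrable_of_hasCompactSupport hρc) (Filter.Eventually.of_forall hn)
    rw [hi] at h1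
    rw [← ENNReal.ofReal_one, h1]
    exact lintegral_congr fun t => Real.enorm_of_nonneg (hn t)
  have hA : eLpNorm (cv (f - g) ρ) (ENNReal.ofReal p) volume ≤ ε / 3 := by
    refine (young hp (hf.sub hg) hρ).trans ?_
    rw [hρint, one_mul]; exact hfg
  have hB : eLpNorm (cv g ρ - g) (ENNReal.ofReal p) volume ≤ ε / 3 := by
    have hb : ∀ x, ‖(cv g ρ - g) x‖ ≤ ‖K.indicator (fun _ => (η : ℝ)) x‖ := by
      intro x
      rw [Pi.sub_apply, ← dist_eq_norm]
      by_cases hx : x ∈ K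
      · rw [Set.indicator_of_mem hx, Real.norm_of_nonneg η.coe_nonneg]
        refine cv_close η.coe_nonneg hg hs hn hi x fun y hy => ?_
        exact (hδ (lt_of_lt_of_le (Metric.mem_ball.1 hy) (min_le_left _ _))).le
      · rw [Set.indicator_of_notMem hx, norm_zero]
        have hz : ∀ y, dist y x < 1 → g y = 0 := by
          intro y hy
          by_contra hne
          exact hx (Metric.mem_cthickening_of_dist_le x y 1 _ (subset_tsupport g hne)
            (by rw [dist_comm]; exact hy.le))
        refine cv_close le_rfl hg hs hn hi x fun y hy => ?_
        rw [hz y (lt_of_lt_of_le (Metric.mem_ball.1 hy) (min_le_right _ _)), hz x (by simp)]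
        simp
    refine (eLpNorm_mono hb).trans ?_
    rw [eLpNorm_indicator_const hKc.measurableSet hP (by simp), ENNReal.toReal_ofReal hp0.le]
    refine le_trans (le_of_eq ?_) hη.le
    congr 1
    simp
  have hC : eLpNorm (g - f) (ENNReal.ofReal p) volume ≤ ε / 3 := by
    rwa [eLpNorm_sub_comm]
  have hfgc : cv (f - g) ρ = cv f ρ - cv g ρ := by
    ext x
    simp only [Pi.sub_apply, cv_apply, sub_mul]
    exact integral_sub (cv_exists hf hρ hρc x) (cv_exists hg hρ hρc x)
  have hcg : Continuous (cv g ρ) :=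
    hρc.continuous_convolution_right _ hg.locallyIntegrable hρ
  have hcfg : Continuous (cv (f - g) ρ) :=
    hρc.continuous_convolution_right _ (hf.sub hg).locallyIntegrable hρ
  have e : cv f ρ - f = cv (f - g) ρ + ((cv g ρ - g) + (g - f)) := by
    rw [hfgc]; abel
  rw [e]
  calc _ ≤ eLpNorm (cv (f - g) ρ) (ENNReal.ofReal p) volume
        + eLpNorm ((cv g ρ - g) + (g - f)) (ENNReal.ofReal p) volume :=
        eLpNorm_add_le hcfg.aestronglyMeasurable
          ((hcg.sub hg).add (hg.sub hf)).aestronglyMeasurable hP1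
    _ ≤ ε / 3 + (ε / 3 + ε / 3) := by
        refine add_le_add hA ((eLpNorm_add_le (hcg.sub hg).aestronglyMeasurable
          (hg.sub hf).aestronglyMeasurable hP1).trans (add_le_add hB hC))
    _ = ε := by rw [← add_assoc, ENNReal.add_thirds]

lemma dct {n : ℕ} {p : ℝ} (hp : 1 < p) {f : EuclideanSpace ℝ (Fin n) → ℝ}
    (hf : Continuous f) (hfp : MemLp f (ENNReal.ofReal p) volume)
    {a : ℕ → EuclideanSpace ℝ (Fin n) → ℝ} (ha : ∀ k, Continuous (a k)) {C : ℝ}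
    (hC : ∀ k x, |a k x| ≤ C)
    (h0 : ∀ x, Filter.Tendsto (fun k => a k x) Filter.atTop (nhds 0)) :
    Filter.Tendsto (fun k => eLpNorm (fun x => a k x * f x) (ENNReal.ofReal p) volume)
      Filter.atTop (nhds 0) := by
  have hp0 : 0 < p := by linarith
  have hP : ENNReal.ofReal p ≠ 0 := by simpa using hp0
  have hCf := (hfp.const_mul C).eLpNorm_lt_top
  rw [eLpNorm_lt_top_iff_lintegral_rpow_enorm_lt_top hP (by simp),
    ENNReal.toReal_ofReal hp0.le] at hCf
  simp only [eLpNorm_eq_lintegral_rpow_enorm_toReal hP ENNReal.ofReal_ne_top,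
    ENNReal.toReal_ofReal hp0.le]
  have key : Filter.Tendsto (fun k => ∫⁻ x, ‖a k x * f x‖ₑ ^ p) Filter.atTop
      (nhds (∫⁻ _ : EuclideanSpace ℝ (Fin n), 0)) := by
    refine tendsto_lintegral_of_dominated_convergence
      (fun x => ‖C * f x‖ₑ ^ p) (fun k => ?_) (fun k => ?_) hCf.ne ?_
    · have := ha k
      exact Measurable.pow_const (by fun_prop) _
    · refine Filter.Eventually.of_forall fun x => ENNReal.rpow_le_rpow ?_ hp0.le
      rw [enorm_le_iff_norm_le, norm_mul, norm_mul]
      exact mul_le_mul_of_nonneg_right ((hC k x).trans (le_abs_self C)) (norm_nonneg _)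
    · refine Filter.Eventually.of_forall fun x => ?_
      have h1 : Filter.Tendsto (fun k => a k x * f x) Filter.atTop (nhds 0) := by
        simpa using (h0 x).mul_const (f x)
      have h2 := (ENNReal.continuous_rpow_const (y := p)).tendsto _ |>.comp h1.enorm
      simpa [hp0, Function.comp_def] using h2
  have h2 := (ENNReal.continuous_rpow_const (y := 1 / p)).tendsto _ |>.comp key
  simpa [hp0, Function.comp_def] using h2

lemma pd_mul {n : ℕ} {a b : EuclideanSpace ℝ (Fin n) → ℝ} (ha : ContDiff ℝ (⊤ : ℕ∞) a)
    (hb : ContDiff ℝ (⊤ : ℕ∞) b) (i : Fin n) :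
    pd (fun x => a x * b x) i = fun x => pd a i x * b x + a x * pd b i x := by
  ext x
  have := (ha.differentiable (by simp) x).hasFDerivAt.mul (hb.differentiable (by simp) x).hasFDerivAt
  unfold pd
  rw [HasFDerivAt.fderiv (f := fun x => a x * b x) this]
  simp
  ring

lemma pd_add {n : ℕ} {a b : EuclideanSpace ℝ (Fin n) → ℝ} (ha : ContDiff ℝ (⊤ : ℕ∞) a)
    (hb : ContDiff ℝ (⊤ : ℕ∞) b) (i : Fin n) :
    pd (fun x => a x + b x) i = fun x => pd a i x + pd b i x := by
  ext x
  have := (ha.differentiable (by simp) x).hasFDerivAt.add (hb.differentiable (by simp) x).hasFDerivAt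
  unfold pd
  rw [HasFDerivAt.fderiv (f := fun x => a x + b x) this]
  simp

lemma lap_mul {n : ℕ} {a b : EuclideanSpace ℝ (Fin n) → ℝ} (ha : ContDiff ℝ (⊤ : ℕ∞) a)
    (hb : ContDiff ℝ (⊤ : ℕ∞) b) (x : EuclideanSpace ℝ (Fin n)) :
    lap (fun x => a x * b x) x
      = a x * lap b x + ∑ i, 2 * pd a i x * pd b i x + lap a x * b x := by
  simp only [lap, pd2, Finset.mul_sum, Finset.sum_mul, ← Finset.sum_add_distrib]
  refine Finset.sum_congr rfl fun i _ => ?_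
  rw [pd_mul ha hb, pd_add ((pd_smooth ha i).mul hb) (ha.mul (pd_smooth hb i)),
    pd_mul (pd_smooth ha i) hb, pd_mul ha (pd_smooth hb i)]
  ring

lemma pd_scale {n : ℕ} {a : EuclideanSpace ℝ (Fin n) → ℝ} (ha : ContDiff ℝ (⊤ : ℕ∞) a)
    (b c : ℝ) (i : Fin n) :
    pd (fun x => b * a (c • x)) i = fun x => (b * c) * pd a i (c • x) := by
  ext x
  have h1 : HasFDerivAt (fun x : EuclideanSpace ℝ (Fin n) => c • x)
      (c • ContinuousLinearMap.id ℝ (EuclideanSpace ℝ (Fin n))) x :=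
    (hasFDerivAt_id x).const_smul c
  have := ((ha.differentiable (by simp) (c • x)).hasFDerivAt.comp x h1).const_mul b
  unfold pd
  rw [HasFDerivAt.fderiv (f := fun x => b * a (c • x)) this]
  simp
  ring

lemma lap_scale {n : ℕ} {a : EuclideanSpace ℝ (Fin n) → ℝ} (ha : ContDiff ℝ (⊤ : ℕ∞) a)
    (c : ℝ) (x : EuclideanSpace ℝ (Fin n)) :
    lap (fun x => 1 * a (c • x)) x = (c * c) * lap a (c • x) := by
  simp only [lap, pd2, Finset.mul_sum]
  refine Finset.sum_congr rfl fun i _ => ?_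
  rw [pd_scale ha, pd_scale (pd_smooth ha i)]
  ring

lemma lap_compact {n : ℕ} {u : EuclideanSpace ℝ (Fin n) → ℝ} (hu : HasCompactSupport u) :
    HasCompactSupport (lap u) := by
  refine HasCompactSupport.intro hu.isCompact fun x hx => ?_
  have h : ∀ i, pd2 u i i x = 0 := fun i => by
    refine image_eq_zero_of_notMem_tsupport fun h => hx ?_
    have h1 := tsupport_fderiv_apply_subset ℝ (f := pd u i) (EuclideanSpace.single i 1) h
    exact tsupport_fderiv_apply_subset ℝ (f := u) (EuclideanSpace.single i 1) h1
  simp [lap, h]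

lemma cutoff {n : ℕ} {p : ℝ} (hp : 1 < p) {v : EuclideanSpace ℝ (Fin n) → ℝ}
    (hv : ContDiff ℝ (⊤ : ℕ∞) v) (h0 : MemLp v (ENNReal.ofReal p) volume)
    (h1 : ∀ i, MemLp (pd v i) (ENNReal.ofReal p) volume)
    (h2 : MemLp (lap v) (ENNReal.ofReal p) volume) :
    ∃ φ : ℕ → EuclideanSpace ℝ (Fin n) → ℝ,
      (∀ k, ContDiff ℝ (⊤ : ℕ∞) (φ k) ∧ HasCompactSupport (φ k)) ∧
      Filter.Tendsto (fun k => eLpNorm (φ k - v) (ENNReal.ofReal p) volume)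
        Filter.atTop (nhds 0) ∧
      Filter.Tendsto (fun k => eLpNorm (lap (φ k) - lap v) (ENNReal.ofReal p) volume)
        Filter.atTop (nhds 0) := by
  have hP1 : 1 ≤ ENNReal.ofReal p := by simpa using hp.le
  let b : ContDiffBump (0 : EuclideanSpace ℝ (Fin n)) := ⟨1, 2, by norm_num, by norm_num⟩
  let χ : EuclideanSpace ℝ (Fin n) → ℝ := b
  have hχ : ContDiff ℝ (⊤ : ℕ∞) χ := b.contDiff
  have hχc : HasCompactSupport χ := b.hasCompactSupport
  let c : ℕ → ℝ := fun k => 1 / ((k : ℝ) + 1)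
  have hc0 : ∀ k, 0 < c k := fun k => by positivity
  have hc1 : ∀ k, c k ≤ 1 := fun k => by
    simp only [c]; rw [div_le_one (by positivity)]; linarith [k.cast_nonneg (α := ℝ)]
  have hct : Filter.Tendsto c Filter.atTop (nhds 0) := tendsto_one_div_add_atTop_nhds_zero_nat
  let a : ℕ → EuclideanSpace ℝ (Fin n) → ℝ := fun k x => 1 * χ (c k • x)
  have hsm : ∀ k, ContDiff ℝ (⊤ : ℕ∞) (a k) := fun k =>
    contDiff_const.mul (hχ.comp (contDiff_const_smul (c k)))
  have hac : ∀ k, HasCompactSupport (a k) := fun k =>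
    (hχc.comp_homeomorph (Homeomorph.smulOfNeZero (c k) (hc0 k).ne')).mul_left
  -- general bound
  have gen : ∀ {g : EuclideanSpace ℝ (Fin n) → ℝ}, Continuous g → HasCompactSupport g →
      ∃ C, (∀ k x, |c k * g (c k • x)| ≤ C) ∧
        ∀ x, Filter.Tendsto (fun k => c k * g (c k • x)) Filter.atTop (nhds 0) := by
    intro g hg hgc
    obtain ⟨C, hC⟩ := hgc.exists_bound_of_continuous hg
    have hb : ∀ k x, |c k * g (c k • x)| ≤ c k * C := fun k x => by
      rw [abs_mul, abs_of_pos (hc0 k)]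
      exact mul_le_mul_of_nonneg_left (hC _) (hc0 k).le
    have hC0 : 0 ≤ C := (norm_nonneg _).trans (hC 0)
    refine ⟨C, fun k x => (hb k x).trans (mul_le_of_le_one_left hC0 (hc1 k)), fun x => ?_⟩
    exact squeeze_zero_norm (fun k => hb k x) (by simpa using hct.mul_const C)
  -- the three kinds of terms
  have tA : ∀ {f : EuclideanSpace ℝ (Fin n) → ℝ}, Continuous f →
      MemLp f (ENNReal.ofReal p) volume → Filter.Tendsto
      (fun k => eLpNorm (fun x => (a k x - 1) * f x) (ENNReal.ofReal p) volume)
      Filter.atTop (nhds 0) := by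
    intro f hf hfp
    refine dct hp hf hfp (C := 1) (fun k => (hsm k).continuous.sub continuous_const) ?_ ?_
    · intro k x
      have e0 : 0 ≤ χ (c k • x) := b.nonneg
      have e1 : χ (c k • x) ≤ 1 := b.le_one
      rw [abs_le]; constructor <;> simp only [a] <;> linarith
    · intro x
      have t1 : Filter.Tendsto (fun k => c k • x) Filter.atTop (nhds 0) := by
        simpa using hct.smul_const x
      have t2 := (hχ.continuous.tendsto 0).comp t1
      have e : χ 0 = 1 := b.one_of_mem_closedBall (by simp [b])
      rw [e] at t2
      simpa [a, Function.comp_def] using t2.sub_const 1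
  have tB : ∀ i, Filter.Tendsto
      (fun k => eLpNorm (fun x => (c k * pd χ i (c k • x)) * pd v i x) (ENNReal.ofReal p) volume)
      Filter.atTop (nhds 0) := by
    intro i
    obtain ⟨C, hC, ht⟩ := gen (pd_smooth hχ i).continuous (pd_compact hχc i)
    have hcont := (pd_smooth hχ i).continuous
    exact dct hp (pd_smooth hv i).continuous (h1 i) (fun k => by fun_prop) hC ht
  have tC : Filter.Tendsto
      (fun k => eLpNorm (fun x => (c k * lap χ (c k • x)) * v x) (ENNReal.ofReal p) volume)
      Filter.atTop (nhds 0) := by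
    obtain ⟨C, hC, ht⟩ := gen (lap_smooth hχ).continuous (lap_compact hχc)
    have hcont := (lap_smooth hχ).continuous
    exact dct hp hv.continuous h0 (fun k => by fun_prop) hC ht
  refine ⟨fun k x => a k x * v x, fun k => ⟨(hsm k).mul hv, (hac k).mul_right⟩, ?_, ?_⟩
  · refine (tA hv.continuous h0).congr fun k => ?_
    congr 1; ext x; simp only [Pi.sub_apply]; ring
  · have hsum := ((tA (lap_smooth hv).continuous h2).add
      ((ENNReal.Tendsto.const_mul (a := 2)
        (tendsto_finsetSum Finset.univ fun i _ => tB i) (by simp)).add tC))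
    simp only [Finset.sum_const_zero, mul_zero, add_zero] at hsum
    refine tendsto_of_tendsto_of_tendsto_of_le_of_le tendsto_const_nhds hsum
      (fun k => bot_le) fun k => ?_
    have hpc := fun i => (pd_smooth hχ i).continuous
    have hpv := fun i => (pd_smooth hv i).continuous
    have hlc := (lap_smooth hχ).continuous
    have hlv := (lap_smooth hv).continuous
    have hvc := hv.continuous
    have hak := (hsm k).continuous
    have e : lap (fun x => a k x * v x) - lap v = (fun x => (a k x - 1) * lap v x) +
        (((2:ℝ) • ∑ i, fun x => (c k * pd χ i (c k • x)) * pd v i x) +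
          c k • fun x => (c k * lap χ (c k • x)) * v x) := by
      ext x
      have hpa : ∀ i, pd (a k) i x = c k * pd χ i (c k • x) := fun i => by
        simp only [a]; rw [pd_scale hχ]; ring
      have hla : lap (a k) x = c k * (c k * lap χ (c k • x)) := by
        simp only [a]; rw [lap_scale hχ]; ring
      rw [Pi.sub_apply, lap_mul (hsm k) hv, hla]
      simp only [hpa, Pi.add_apply, Pi.smul_apply, Finset.sum_apply, smul_eq_mul, Finset.mul_sum,
        mul_assoc]
      ring
    have mB : Continuous (∑ i, fun x => (c k * pd χ i (c k • x)) * pd v i x) := by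
      rw [Finset.sum_fn]
      exact continuous_finsetSum _ fun i _ => by fun_prop
    simp only [e]
    refine (eLpNorm_add_le (Continuous.aestronglyMeasurable (by fun_prop))
      (Continuous.aestronglyMeasurable (by fun_prop)) hP1).trans (add_le_add le_rfl ?_)
    refine (eLpNorm_add_le (Continuous.aestronglyMeasurable (by fun_prop))
      (Continuous.aestronglyMeasurable (by fun_prop)) hP1).trans (add_le_add ?_ ?_)
    · rw [eLpNorm_const_smul]
      refine mul_le_mul' (by simp [Real.enorm_eq_ofReal]) ?_
      exact eLpNorm_sum_le (fun i _ => Continuous.aestronglyMeasurable (by fun_prop)) hP1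
    · rw [eLpNorm_const_smul]
      refine mul_le_of_le_one_left' ?_
      rw [Real.enorm_of_nonneg (hc0 k).le]
      simpa using hc1 k

lemma approx {n : ℕ} {p : ℝ} (hp : 1 < p) {u : EuclideanSpace ℝ (Fin n) → ℝ}
    (hu : ContDiff ℝ (⊤ : ℕ∞) u) (h0 : MemLp u (ENNReal.ofReal p) volume)
    (h2 : MemLp (lap u) (ENNReal.ofReal p) volume) {ε : ℝ≥0∞} (hε : ε ≠ 0) :
    ∃ φ : EuclideanSpace ℝ (Fin n) → ℝ, ContDiff ℝ (⊤ : ℕ∞) φ ∧ HasCompactSupport φ ∧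
      eLpNorm (φ - u) (ENNReal.ofReal p) volume ≤ ε ∧
      eLpNorm (lap φ - lap u) (ENNReal.ofReal p) volume ≤ ε := by
  have hP1 : 1 ≤ ENNReal.ofReal p := by simpa using hp.le
  have hε2 : ε / 2 ≠ 0 := (ENNReal.div_pos hε (by norm_num)).ne'
  obtain ⟨δ₁, hδ₁, H₁⟩ := mollify hp hu.continuous h0 hε2
  obtain ⟨δ₂, hδ₂, H₂⟩ := mollify hp (lap_smooth hu).continuous h2 hε2
  have hδ : 0 < min δ₁ δ₂ := lt_min hδ₁ hδ₂
  let b : ContDiffBump (0 : EuclideanSpace ℝ (Fin n)) :=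
    ⟨min δ₁ δ₂ / 2, min δ₁ δ₂, by linarith, by linarith⟩
  let ρ : EuclideanSpace ℝ (Fin n) → ℝ := b.normed volume
  have hρ : ContDiff ℝ (⊤ : ℕ∞) ρ := b.contDiff_normed
  have hρc : HasCompactSupport ρ := b.hasCompactSupport_normed
  have hs : Function.support ρ = Metric.ball 0 (min δ₁ δ₂) := b.support_normed_eq
  have A₁ := H₁ ρ hρ.continuous hρc (hs.trans_subset (Metric.ball_subset_ball (min_le_left _ _)))
    b.nonneg_normed b.integral_normed
  have A₂ := H₂ ρ hρ.continuous hρc (hs.trans_subset (Metric.ball_subset_ball (min_le_right _ _)))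
    b.nonneg_normed b.integral_normed
  rw [← lap_cv hu hρ hρc] at A₂
  have mem : ∀ {f g : EuclideanSpace ℝ (Fin n) → ℝ}, Continuous f →
      MemLp f (ENNReal.ofReal p) volume → Continuous g → HasCompactSupport g →
      MemLp (cv f g) (ENNReal.ofReal p) volume := by
    intro f g hf hfp hg hgc
    refine ⟨(hgc.continuous_convolution_right _ hf.locallyIntegrable hg).aestronglyMeasurable,
      (young hp hf hg).trans_lt (ENNReal.mul_lt_top ?_ hfp.2)⟩
    exact (hg.integrable_of_hasCompactSupport hgc).2
  have hv := cv_smooth hu.continuous hρ hρc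
  obtain ⟨φ, hφ, t0, t2⟩ := cutoff hp hv (mem hu.continuous h0 hρ.continuous hρc)
    (fun i => by
      rw [pd_cv_right hu.continuous hρ hρc]
      exact mem hu.continuous h0 (pd_smooth hρ i).continuous (pd_compact hρc i))
    (by
      rw [lap_cv hu hρ hρc]
      exact mem (lap_smooth hu).continuous h2 hρ.continuous hρc)
  obtain ⟨k, k0, k2⟩ := ((t0.eventually_le_const (pos_iff_ne_zero.2 hε2)).and
    (t2.eventually_le_const (pos_iff_ne_zero.2 hε2))).exists
  refine ⟨φ k, (hφ k).1, (hφ k).2, ?_, ?_⟩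
  · have e : φ k - u = (φ k - cv u ρ) + (cv u ρ - u) := by abel
    rw [e, ← ENNReal.add_halves ε]
    exact (eLpNorm_add_le ((hφ k).1.continuous.sub hv.continuous).aestronglyMeasurable
      (hv.continuous.sub hu.continuous).aestronglyMeasurable hP1).trans (add_le_add k0 A₁)
  · have e : lap (φ k) - lap u = (lap (φ k) - lap (cv u ρ)) + (lap (cv u ρ) - lap u) := by abel
    rw [e, ← ENNReal.add_halves ε]
    exact (eLpNorm_add_le
      ((lap_smooth (hφ k).1).continuous.sub (lap_smooth hv).continuous).aestronglyMeasurable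
      ((lap_smooth hv).continuous.sub (lap_smooth hu).continuous).aestronglyMeasurable
      hP1).trans (add_le_add k2 A₂)

lemma lpNorm_le {n : ℕ} {p : ℝ} (hp : 1 < p) {f : EuclideanSpace ℝ (Fin n) → ℝ}
    (hf : Continuous f) {ε : ℝ} (hε : 0 ≤ ε)
    (h : eLpNorm f (ENNReal.ofReal p) volume ≤ ENNReal.ofReal ε) : _root_.lpNorm p f ≤ ε := by
  have hp0 : 0 < p := by linarith
  have hP : ENNReal.ofReal p ≠ 0 := by simpa using hp0
  have e := lpNorm_eq_integral_norm_rpow_toReal hP (by simp)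
    (hf.aestronglyMeasurable (μ := volume))
  rw [ENNReal.toReal_ofReal hp0.le, ← toReal_eLpNorm hf.aestronglyMeasurable] at e
  have e2 : _root_.lpNorm p f = (eLpNorm f (ENNReal.ofReal p) volume).toReal := by
    rw [e, _root_.lpNorm, one_div]; rfl
  rw [e2]
  exact ENNReal.toReal_le_of_le_ofReal hε h

end aux

/-- Milatovic's density theorem specialized to `ℝⁿ`: if `u` is smooth with
`u, Δu ∈ L^p` (`1 < p < ∞`), there is a sequence `φ_k ∈ C_c^∞(ℝⁿ)` with
`‖φ_k − u‖_p → 0` and `‖Δφ_k − Δu‖_p → 0`. -/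
theorem density_of_compactly_supported_in_W2p_tilde (n : ℕ) (hn : 1 ≤ n)
    (p : ℝ) (hp : 1 < p) (u : EuclideanSpace ℝ (Fin n) → ℝ) (hu : ContDiff ℝ (⊤ : ℕ∞) u)
    (huLp : Integrable (fun x => |u x| ^ p))
    (hlapLp : Integrable (fun x => |lap u x| ^ p)) :
    ∃ φ : ℕ → EuclideanSpace ℝ (Fin n) → ℝ,
      (∀ k, ContDiff ℝ (⊤ : ℕ∞) (φ k) ∧ HasCompactSupport (φ k)) ∧
      Filter.Tendsto (fun k => lpNorm p (fun x => φ k x - u x)) Filter.atTop (nhds 0) ∧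
      Filter.Tendsto (fun k => lpNorm p (fun x => lap (φ k) x - lap u x))
        Filter.atTop (nhds 0) := by
  have hp0 : 0 < p := by linarith
  have hP : ENNReal.ofReal p ≠ 0 := by simpa using hp0
  have mem : ∀ {f : EuclideanSpace ℝ (Fin n) → ℝ}, Continuous f →
      Integrable (fun x => |f x| ^ p) → MemLp f (ENNReal.ofReal p) volume := by
    intro f hf hi
    rw [← integrable_norm_rpow_iff hf.aestronglyMeasurable hP (by simp),
      ENNReal.toReal_ofReal hp0.le]
    exact hi
  have H := fun k : ℕ => approx hp hu (mem hu.continuous huLp)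
    (mem (lap_smooth hu).continuous hlapLp)
    (ε := ENNReal.ofReal (1 / ((k : ℝ) + 1))) (by simp; positivity)
  choose φ h1 h2 h3 h4 using H
  refine ⟨φ, fun k => ⟨h1 k, h2 k⟩, ?_, ?_⟩
  · refine squeeze_zero (fun k => ?_) (fun k => lpNorm_le hp
      ((h1 k).continuous.sub hu.continuous) (by positivity) (h3 k))
      tendsto_one_div_add_atTop_nhds_zero_nat
    unfold _root_.lpNorm; positivity
  · refine squeeze_zero (fun k => ?_) (fun k => lpNorm_le hp
      ((lap_smooth (h1 k)).continuous.sub (lap_smooth hu).continuous) (by positivity) (h4 k))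
      tendsto_one_div_add_atTop_nhds_zero_nat
    unfold _root_.lpNorm; positivity
end

section
/- Failure of the L^∞ Calderón–Zygmund inequality: for every n ≥ 2 there is no constant C > 0 such that sup_{ℝⁿ} |Hess φ| ≤ C sup_{ℝⁿ} |Δφ| holds for all smooth compactly supported functions φ : ℝⁿ → ℝ. -/
open MeasureTheory

lemma aux_pd_sum {n : ℕ} (ψ : EuclideanSpace ℝ (Fin n) → ℝ) (h : Differentiable ℝ ψ)
    (a c : ℕ → ℝ) (N : ℕ) (i : Fin n) :
    pd (fun x => ∑ k ∈ Finset.range N, a k * ψ (c k • x)) i =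
      fun x => ∑ k ∈ Finset.range N, (a k * c k) * pd ψ i (c k • x) := by
  funext x
  have h1 : ∀ k : ℕ, HasFDerivAt (fun x => a k * ψ (c k • x))
      (a k • ((fderiv ℝ ψ (c k • x)).comp
        (c k • ContinuousLinearMap.id ℝ (EuclideanSpace ℝ (Fin n))))) x := by
    intro k
    have h2 : HasFDerivAt (fun x : EuclideanSpace ℝ (Fin n) => c k • x)
        (c k • ContinuousLinearMap.id ℝ (EuclideanSpace ℝ (Fin n))) x :=
      (hasFDerivAt_id x).const_smul (c k)
    exact ((h (c k • x)).hasFDerivAt.comp x h2).const_mul (a k)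
  have h3 := HasFDerivAt.fun_sum (u := Finset.range N) (fun k _ => h1 k)
  unfold pd
  rw [h3.fderiv]
  simp [mul_assoc]

lemma aux_pd_congr {n : ℕ} {u v : EuclideanSpace ℝ (Fin n) → ℝ}
    {U : Set (EuclideanSpace ℝ (Fin n))} (hU : IsOpen U) (h : Set.EqOn u v U) (i : Fin n) :
    Set.EqOn (pd u i) (pd v i) U := by
  intro x hx
  unfold pd
  rw [(h.eventuallyEq_of_mem (hU.mem_nhds hx)).fderiv_eq]

lemma aux_pd_contDiff {n : ℕ} {u : EuclideanSpace ℝ (Fin n) → ℝ}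
    (h : ContDiff ℝ (⊤ : ℕ∞) u) (i : Fin n) : ContDiff ℝ (⊤ : ℕ∞) (pd u i) := by
  unfold pd
  exact (h.fderiv_right (by simp)).clm_apply contDiff_const

lemma aux_pd_supp {n : ℕ} {u : EuclideanSpace ℝ (Fin n) → ℝ}
    (h : HasCompactSupport u) (i : Fin n) : HasCompactSupport (pd u i) :=
  h.fderiv_apply ℝ _

lemma aux_bdd {n : ℕ} {u : EuclideanSpace ℝ (Fin n) → ℝ}
    (h : ContDiff ℝ (⊤ : ℕ∞) u) (hc : HasCompactSupport u) (i j : Fin n) :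
    ∃ B, ∀ x, |pd2 u i j x| ≤ B :=
  (aux_pd_contDiff (aux_pd_contDiff h j) i).continuous.bounded_above_of_compact_support
    (aux_pd_supp (aux_pd_supp hc j) i)

lemma aux_pd_q {n : ℕ} (a b i : Fin n) :
    pd (fun x : EuclideanSpace ℝ (Fin n) => x a * x b) i =
      fun x => (if i = b then 1 else 0) * x a + (if i = a then 1 else 0) * x b := by
  funext x
  have h : ∀ a : Fin n, HasFDerivAt (fun x : EuclideanSpace ℝ (Fin n) => x a)
      (EuclideanSpace.proj a : EuclideanSpace ℝ (Fin n) →L[ℝ] ℝ) x := fun a =>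
    (EuclideanSpace.proj a : EuclideanSpace ℝ (Fin n) →L[ℝ] ℝ).hasFDerivAt
  unfold pd
  rw [((h a).fun_mul (h b)).fderiv]
  simp [eq_comm]

lemma aux_pd2_q {n : ℕ} (a b i j : Fin n) (x : EuclideanSpace ℝ (Fin n)) :
    pd2 (fun x : EuclideanSpace ℝ (Fin n) => x a * x b) i j x =
      (if j = b then 1 else 0) * (if i = a then 1 else 0) +
        (if j = a then 1 else 0) * (if i = b then 1 else 0) := by
  have h : ∀ a : Fin n, HasFDerivAt (fun x : EuclideanSpace ℝ (Fin n) => x a)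
      (EuclideanSpace.proj a : EuclideanSpace ℝ (Fin n) →L[ℝ] ℝ) x := fun a =>
    (EuclideanSpace.proj a : EuclideanSpace ℝ (Fin n) →L[ℝ] ℝ).hasFDerivAt
  unfold pd2
  rw [aux_pd_q]
  unfold pd
  rw [(((h a).const_mul _).fun_add ((h b).const_mul _)).fderiv]
  simp only [ContinuousLinearMap.add_apply, ContinuousLinearMap.smul_apply, smul_eq_mul]
  simp [eq_comm]

theorem no_Linfty_calderon_zygmund (n : ℕ) (hn : 2 ≤ n) :
    ¬ ∃ C : ℝ, 0 < C ∧ ∀ φ : EuclideanSpace ℝ (Fin n) → ℝ,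
      ContDiff ℝ (⊤ : ℕ∞) φ → HasCompactSupport φ →
      (⨆ x, hessNorm φ x) ≤ C * ⨆ x, |lap φ x| := by
  rintro ⟨C, hC, H⟩
  let a : Fin n := ⟨0, by omega⟩
  let b : Fin n := ⟨1, by omega⟩
  have hab : a ≠ b := by simp [a, b]
  let η : ContDiffBump (0 : EuclideanSpace ℝ (Fin n)) := ⟨1, 2, by norm_num, by norm_num⟩
  let q : EuclideanSpace ℝ (Fin n) → ℝ := fun x => x a * x b
  let ψ : EuclideanSpace ℝ (Fin n) → ℝ := fun x => η x * q x
  have hq : ContDiff ℝ (⊤ : ℕ∞) q := by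
    have h : ∀ a : Fin n, ContDiff ℝ (⊤ : ℕ∞) (fun x : EuclideanSpace ℝ (Fin n) => x a) :=
      fun a => (EuclideanSpace.proj a : EuclideanSpace ℝ (Fin n) →L[ℝ] ℝ).contDiff
    exact (h a).mul (h b)
  have hψ : ContDiff ℝ (⊤ : ℕ∞) ψ := η.contDiff.mul hq
  have hψc : HasCompactSupport ψ := η.hasCompactSupport.mul_right
  have hin : Set.EqOn ψ q (Metric.ball 0 1) := by
    intro x hx
    have : η x = 1 := η.one_of_mem_closedBall (Metric.ball_subset_closedBall hx)
    simp [ψ, this]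
  have hout : Set.EqOn ψ (fun _ => 0) (Metric.closedBall 0 2)ᶜ := by
    intro x hx
    have : η x = 0 := η.zero_of_le_dist (by
      simp only [Set.mem_compl_iff, Metric.mem_closedBall, not_le] at hx
      exact hx.le)
    simp [ψ, this]
  have hin2 : ∀ i j, ∀ x ∈ Metric.ball 0 1, pd2 ψ i j x = pd2 q i j x := fun i j x hx =>
    aux_pd_congr Metric.isOpen_ball (aux_pd_congr Metric.isOpen_ball hin j) i hx
  have hout2 : ∀ i j, ∀ x ∈ (Metric.closedBall (0 : EuclideanSpace ℝ (Fin n)) 2)ᶜ,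
      pd2 ψ i j x = 0 := by
    intro i j x hx
    have ho := (Metric.isClosed_closedBall (x := (0 : EuclideanSpace ℝ (Fin n)))
      (ε := 2)).isOpen_compl
    have := aux_pd_congr ho (aux_pd_congr ho hout j) i hx
    unfold pd2
    rw [this]
    have e : pd (fun _ : EuclideanSpace ℝ (Fin n) => (0 : ℝ)) j = fun _ => 0 := by
      funext y; simp [pd]
    rw [e]; simp [pd]
  have hlap : ∀ x, lap ψ x ≠ 0 → 1 ≤ ‖x‖ ∧ ‖x‖ ≤ 2 := by
    intro x hx
    constructor
    · by_contra hlt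
      apply hx
      unfold lap
      apply Finset.sum_eq_zero
      intro i _
      rw [hin2 i i x (by simpa using hlt), aux_pd2_q]
      by_cases h1 : i = a
      · have h2 : i ≠ b := fun h => hab (h1.symm.trans h)
        simp [h2]
      · simp [h1]
    · by_contra hlt
      apply hx
      unfold lap
      apply Finset.sum_eq_zero
      intro i _
      exact hout2 i i x (by simpa using hlt)
  choose B hB using fun i => aux_bdd hψ hψc i i
  let M := ∑ i, B i
  have hM : ∀ x, |lap ψ x| ≤ M := fun x =>
    (Finset.abs_sum_le_sum_abs _ _).trans (Finset.sum_le_sum fun i _ => hB i x)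
  have hM0 : 0 ≤ M := (abs_nonneg _).trans (hM 0)
  have key : ∀ N : ℕ, (N : ℝ) ≤ C * M := by
    intro N
    let φ : EuclideanSpace ℝ (Fin n) → ℝ :=
      fun x => ∑ k ∈ Finset.range N, ((16 : ℝ) ^ k)⁻¹ * ψ ((4 : ℝ) ^ k • x)
    have hφ : ContDiff ℝ (⊤ : ℕ∞) φ := by
      apply ContDiff.sum
      intro k _
      exact contDiff_const.mul (hψ.comp (contDiff_const_smul _))
    have hφc : HasCompactSupport φ := by
      refine HasCompactSupport.intro (isCompact_closedBall (0 : EuclideanSpace ℝ (Fin n)) 2) ?_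
      intro x hx
      apply Finset.sum_eq_zero
      intro k _
      have : ψ ((4 : ℝ) ^ k • x) = 0 := by
        apply hout
        simp only [Set.mem_compl_iff, Metric.mem_closedBall, not_le, dist_zero_right] at hx ⊢
        rw [norm_smul, Real.norm_of_nonneg (by positivity)]
        have : (1 : ℝ) ≤ 4 ^ k := one_le_pow₀ (by norm_num)
        nlinarith
      rw [this, mul_zero]
    have hpd2 : ∀ i j x, pd2 φ i j x = ∑ k ∈ Finset.range N, pd2 ψ i j ((4 : ℝ) ^ k • x) := by
      intro i j x
      unfold pd2
      rw [aux_pd_sum ψ (hψ.differentiable (by simp)),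
        aux_pd_sum (pd ψ j) ((aux_pd_contDiff hψ j).differentiable (by simp))]
      apply Finset.sum_congr rfl
      intro k _
      have : ((16 : ℝ) ^ k)⁻¹ * 4 ^ k * 4 ^ k = 1 := by
        rw [mul_assoc, ← mul_pow]
        norm_num
      rw [this, one_mul]
    have hl : ∀ x, lap φ x = ∑ k ∈ Finset.range N, lap ψ ((4 : ℝ) ^ k • x) := by
      intro x
      unfold lap
      rw [Finset.sum_comm]
      exact Finset.sum_congr rfl fun i _ => hpd2 i i x
    have hub : ∀ x, |lap φ x| ≤ M := by
      intro x
      rw [hl]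
      by_cases hz : ∃ k ∈ Finset.range N, lap ψ ((4 : ℝ) ^ k • x) ≠ 0
      · obtain ⟨k, hk, hk0⟩ := hz
        have hlt : ∀ i j : ℕ, i < j → lap ψ ((4 : ℝ) ^ i • x) ≠ 0 →
            lap ψ ((4 : ℝ) ^ j • x) ≠ 0 → False := by
          intro i j hij hi hj
          have h1 := (hlap _ hi).1
          have h2 := (hlap _ hj).2
          rw [norm_smul, Real.norm_of_nonneg (by positivity)] at h1 h2
          have h3 : (4 : ℝ) ^ (i + 1) ≤ 4 ^ j := pow_le_pow_right₀ (by norm_num) hij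
          rw [pow_succ] at h3
          have := mul_le_mul_of_nonneg_right h3 (norm_nonneg x)
          nlinarith
        rw [Finset.sum_eq_single_of_mem k hk]
        · exact hM _
        · intro j _ hjk
          by_contra hj
          rcases lt_or_gt_of_ne hjk with h | h
          · exact hlt _ _ h hj hk0
          · exact hlt _ _ h hk0 hj
      · push Not at hz
        rw [Finset.sum_eq_zero hz]
        simpa using hM0
    have hbdd : BddAbove (Set.range (hessNorm φ)) := by
      choose D hD using fun i j => aux_bdd hφ hφc i j
      refine ⟨Real.sqrt (∑ i, ∑ j, D i j ^ 2), ?_⟩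
      rintro _ ⟨x, rfl⟩
      apply Real.sqrt_le_sqrt
      refine Finset.sum_le_sum fun i _ => Finset.sum_le_sum fun j _ => ?_
      exact sq_le_sq.2 ((hD i j x).trans (le_abs_self _))
    have h0 : pd2 φ a b 0 = N := by
      rw [hpd2]
      have : pd2 ψ a b 0 = 1 := by
        rw [hin2 a b 0 (by simp), aux_pd2_q]
        simp [hab, hab.symm]
      simp [this]
    have hN : (N : ℝ) ≤ hessNorm φ 0 := by
      apply Real.le_sqrt_of_sq_le
      rw [← h0]
      calc pd2 φ a b 0 ^ 2 ≤ ∑ j, pd2 φ a j 0 ^ 2 :=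
            Finset.single_le_sum (f := fun j => pd2 φ a j 0 ^ 2)
              (fun j _ => sq_nonneg _) (Finset.mem_univ b)
        _ ≤ _ := Finset.single_le_sum (f := fun i => ∑ j, pd2 φ i j 0 ^ 2)
              (fun i _ => Finset.sum_nonneg fun j _ => sq_nonneg _) (Finset.mem_univ a)
    calc (N : ℝ) ≤ hessNorm φ 0 := hN
      _ ≤ ⨆ x, hessNorm φ x := le_ciSup hbdd 0
      _ ≤ C * ⨆ x, |lap φ x| := H φ hφ hφc
      _ ≤ C * M := mul_le_mul_of_nonneg_left (ciSup_le hub) hC.le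
  obtain ⟨N, hN⟩ := exists_nat_gt (C * M)
  exact absurd (key N) (not_le.2 hN)
end

section
/- Failure of the L^p gradient estimate on punctured Euclidean space: let m ≥ 3 and let p satisfy m/(m−1) < p < m/(m−2). Then there exists a smooth function u on the open set M = ℝ^m \\ {0} such that ∫_M |u|^p dx < ∞ and ∫_M |Δu|^p dx < ∞, but ∫_M |∇u|^p dx = ∞. (One may take u = φ·G where G(x) = |x|^{2−m} and φ is a smooth compactly supported cut-off equal to 1 near 0.) -/
open MeasureTheory

namespace PSGF

open Set Filter Topology

abbrev E (m : ℕ) := EuclideanSpace ℝ (Fin m)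

lemma rad_int (m : ℕ) (hm : 3 ≤ m) (a r : ℝ) (hr : 0 < r) :
    IntegrableOn (fun x : E m => ‖x‖ ^ a) (Metric.ball 0 r) ↔ -(m : ℝ) < a := by
  have : Nonempty (Fin m) := ⟨⟨0, by omega⟩⟩
  have : Nontrivial (E m) := inferInstance
  rw [integrableOn_fun_norm_addHaar (μ := (volume : Measure (E m))) (f := fun y : ℝ => y ^ a)]
  rw [integrableOn_congr_fun (g := fun y : ℝ => y ^ ((m : ℝ) - 1 + a)) _ measurableSet_Ioo]
  · rw [intervalIntegral.integrableOn_Ioo_rpow_iff hr]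
    constructor <;> intro h <;> linarith
  · intro y hy
    have hy0 : 0 < y := hy.1
    simp only [finrank_euclideanSpace_fin, smul_eq_mul]
    rw [Real.rpow_add hy0, ← Real.rpow_natCast]
    congr 2
    rw [Nat.cast_sub (by omega)]
    simp

lemma G_deriv {m : ℕ} (s : ℝ) (x : E m) (hx : x ≠ 0) :
    HasFDerivAt (fun x : E m => (‖x‖ ^ 2) ^ s)
      ((s * (‖x‖ ^ 2) ^ (s - 1)) • (2 • (innerSL ℝ x))) x := by
  have h1 := (hasStrictFDerivAt_norm_sq x).hasFDerivAt
  exact h1.rpow_const (Or.inl (by positivity))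

lemma pd_G {m : ℕ} (s : ℝ) (x : E m) (hx : x ≠ 0) (i : Fin m) :
    pd (fun x : E m => (‖x‖ ^ 2) ^ s) i x = 2 * s * ((‖x‖ ^ 2) ^ (s - 1) * x i) := by
  unfold pd
  rw [(G_deriv s x hx).fderiv]
  simp [EuclideanSpace.inner_single_right]
  ring

lemma pd2_G {m : ℕ} (s : ℝ) (x : E m) (hx : x ≠ 0) (i : Fin m) :
    pd2 (fun x : E m => (‖x‖ ^ 2) ^ s) i i x =
      2 * s * ((‖x‖ ^ 2) ^ (s - 1) + 2 * (s - 1) * ((‖x‖ ^ 2) ^ (s - 1 - 1) * (x i) ^ 2)) := by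
  have hev : pd (fun x : E m => (‖x‖ ^ 2) ^ s) i =ᶠ[𝓝 x]
      fun x => 2 * s * ((‖x‖ ^ 2) ^ (s - 1) * x i) := by
    filter_upwards [isOpen_ne.mem_nhds hx] with y hy
    exact pd_G s y hy i
  have hc : HasFDerivAt (fun x : E m => x i) (EuclideanSpace.proj i : E m →L[ℝ] ℝ) x :=
    (EuclideanSpace.proj i : E m →L[ℝ] ℝ).hasFDerivAt
  have h2 := ((G_deriv (s - 1) x hx).mul hc).const_mul (2 * s)
  unfold pd2
  rw [pd, hev.fderiv_eq]
  erw [h2.fderiv]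
  simp [EuclideanSpace.inner_single_right]
  ring

lemma lap_G {m : ℕ} (s : ℝ) (hs : 2 * s = 2 - m) (x : E m) (hx : x ≠ 0) :
    lap (fun x : E m => (‖x‖ ^ 2) ^ s) x = 0 := by
  unfold lap
  simp_rw [pd2_G s x hx]
  rw [← Finset.mul_sum, Finset.sum_add_distrib, ← Finset.mul_sum, ← Finset.mul_sum,
    ← EuclideanSpace.real_norm_sq_eq]
  have hpos : 0 < ‖x‖ ^ 2 := by positivity
  have : (‖x‖ ^ 2) ^ (s - 1 - 1) * ‖x‖ ^ 2 = (‖x‖ ^ 2) ^ (s - 1) := by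
    rw [Real.rpow_sub_one hpos.ne' (s - 1)]
    field_simp
  rw [this]
  simp
  right
  linear_combination (‖x‖ ^ 2) ^ (s - 1) * hs

lemma gradNorm_G {m : ℕ} (hm : 3 ≤ m) (s : ℝ) (hs : 2 * s = 2 - m) (x : E m) (hx : x ≠ 0) :
    gradNorm (fun x : E m => (‖x‖ ^ 2) ^ s) x = (m - 2) * ‖x‖ ^ (1 - m : ℝ) := by
  unfold gradNorm
  simp_rw [pd_G s x hx, mul_pow]
  rw [← Finset.mul_sum, ← Finset.mul_sum, ← EuclideanSpace.real_norm_sq_eq]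
  have hpos : 0 < ‖x‖ := by positivity
  have hm' : (3 : ℝ) ≤ m := by exact_mod_cast hm
  have h1 : ((‖x‖ ^ 2) ^ (s - 1)) * ‖x‖ = ‖x‖ ^ (1 - m : ℝ) := by
    rw [← Real.rpow_natCast ‖x‖ 2, ← Real.rpow_mul hpos.le, ← Real.rpow_add_one hpos.ne']
    congr 1
    push_cast
    linarith
  rw [← h1, Real.sqrt_eq_iff_mul_self_eq_of_pos]
  · have : (m : ℝ) = 2 - 2 * s := by linarith
    rw [this]; ring
  · have : (0 : ℝ) < m - 2 := by linarith
    positivity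

lemma pd_congr {m : ℕ} {u v : E m → ℝ} {x : E m} (h : u =ᶠ[𝓝 x] v) (i : Fin m) :
    pd u i =ᶠ[𝓝 x] pd v i := by
  filter_upwards [h.fderiv (𝕜 := ℝ)] with y hy
  simp [pd, hy]

lemma lap_congr {m : ℕ} {u v : E m → ℝ} {x : E m} (h : u =ᶠ[𝓝 x] v) : lap u x = lap v x := by
  unfold lap pd2
  exact Finset.sum_congr rfl fun i _ => (pd_congr (pd_congr h i) i).eq_of_nhds

lemma gradNorm_congr {m : ℕ} {u v : E m → ℝ} {x : E m} (h : u =ᶠ[𝓝 x] v) :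
    gradNorm u x = gradNorm v x := by
  unfold gradNorm
  congr 1
  exact Finset.sum_congr rfl fun i _ => by rw [(pd_congr h i).eq_of_nhds]

lemma pd_smooth {m : ℕ} {u : E m → ℝ} (hu : ContDiffOn ℝ (⊤ : ℕ∞) u {x | x ≠ 0}) (i : Fin m) :
    ContDiffOn ℝ (⊤ : ℕ∞) (pd u i) {x | x ≠ 0} :=
  (hu.fderiv_of_isOpen isOpen_ne (m := ((⊤ : ℕ∞) : WithTop ℕ∞)) (by simp)).clm_apply
    contDiffOn_const

lemma lap_cont {m : ℕ} {u : E m → ℝ} (hu : ContDiffOn ℝ (⊤ : ℕ∞) u {x | x ≠ 0}) :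
    ContinuousOn (lap u) {x | x ≠ 0} := by
  unfold lap
  exact continuousOn_finsetSum _ fun i _ => (pd_smooth (pd_smooth hu i) i).continuousOn

lemma ae_ne {m : ℕ} (hm : 3 ≤ m) : ∀ᵐ x : E m, x ≠ 0 := by
  have : Nonempty (Fin m) := ⟨⟨0, by omega⟩⟩
  have : Nontrivial (E m) := inferInstance
  exact Measure.ae_ne volume 0

end PSGF

open PSGF Set Filter Topology

/-- Failure of the `L^p` gradient estimate on punctured Euclidean space: for `m ≥ 3`
and `m/(m−1) < p < m/(m−2)` there is a function `u`, smooth on `ℝᵐ \ {0}`, with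
`|u|^p` and `|Δu|^p` integrable on `ℝᵐ \ {0}` but `|∇u|^p` not integrable there. -/
theorem punctured_space_gradient_failure (m : ℕ) (hm : 3 ≤ m) (p : ℝ)
    (hp1 : (m : ℝ) / ((m : ℝ) - 1) < p) (hp2 : p < (m : ℝ) / ((m : ℝ) - 2)) :
    ∃ u : EuclideanSpace ℝ (Fin m) → ℝ,
      ContDiffOn ℝ (⊤ : ℕ∞) u {x | x ≠ 0} ∧
      IntegrableOn (fun x => |u x| ^ p) {x | x ≠ 0} ∧
      IntegrableOn (fun x => |lap u x| ^ p) {x | x ≠ 0} ∧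
      ¬ IntegrableOn (fun x => |gradNorm u x| ^ p) {x | x ≠ 0} := by
  have hm' : (3 : ℝ) ≤ m := by exact_mod_cast hm
  have hp1' : (m : ℝ) < p * (m - 1) := (div_lt_iff₀ (by linarith)).1 hp1
  have hp2' : p * (m - 2) < (m : ℝ) := (lt_div_iff₀ (by linarith)).1 hp2
  have hp0 : 0 < p := lt_trans (div_pos (by linarith) (by linarith)) hp1
  obtain ⟨s, hs⟩ : ∃ s : ℝ, 2 * s = 2 - m := ⟨(2 - m) / 2, by ring⟩
  let φ : ContDiffBump (0 : E m) := ⟨1, 2, one_pos, one_lt_two⟩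
  have hφin : ∀ x : E m, x ∈ Metric.ball (0 : E m) 1 → φ x = 1 := fun x hx =>
    φ.one_of_mem_closedBall (Metric.ball_subset_closedBall hx)
  have hφout : ∀ x : E m, 2 ≤ ‖x‖ → φ x = 0 := fun x hx =>
    φ.zero_of_le_dist (by simpa using hx)
  let G : E m → ℝ := fun x => (‖x‖ ^ 2) ^ s
  let u : E m → ℝ := fun x => φ x * G x
  have hG : ContDiffOn ℝ (⊤ : ℕ∞) G {x | x ≠ 0} := by
    refine ContDiffOn.rpow_const_of_ne (contDiff_norm_sq ℝ).contDiffOn ?_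
    intro x hx
    have : x ≠ 0 := hx
    positivity
  have hu : ContDiffOn ℝ (⊤ : ℕ∞) u {x | x ≠ 0} := φ.contDiff.contDiffOn.mul hG
  have hGn : ∀ x : E m, G x = ‖x‖ ^ (2 - m : ℝ) := by
    intro x
    change (‖x‖ ^ 2) ^ s = _
    rw [← Real.rpow_natCast ‖x‖ 2, ← Real.rpow_mul (norm_nonneg _)]
    congr 1
  have hms : MeasurableSet {x : E m | x ≠ 0} := isOpen_ne.measurableSet
  have huG : ∀ x ∈ Metric.ball (0 : E m) 1, u =ᶠ[𝓝 x] G := by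
    intro x hx
    filter_upwards [Metric.isOpen_ball.mem_nhds hx] with y hy
    simp [u, hφin y hy]
  refine ⟨u, hu, ?_, ?_, ?_⟩
  · have hb : IntegrableOn (fun x : E m => ‖x‖ ^ ((2 - m : ℝ) * p)) (Metric.ball 0 2) :=
      (rad_int m hm _ 2 two_pos).2 (by nlinarith)
    have hb2 := (integrable_indicator_iff (μ := volume) Metric.isOpen_ball.measurableSet).2 hb
    refine (hb2.integrableOn (s := {x | x ≠ 0})).mono' ?_ ?_
    · refine ContinuousOn.aestronglyMeasurable ?_ hms
      exact (hu.continuousOn.abs).rpow_const fun x _ => Or.inr hp0.le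
    · refine ae_of_all _ fun x => ?_
      rw [Real.norm_of_nonneg (by positivity)]
      by_cases hx : x ∈ Metric.ball (0 : E m) 2
      · rw [indicator_of_mem hx, Real.rpow_mul (norm_nonneg _), ← hGn]
        refine Real.rpow_le_rpow (abs_nonneg _) ?_ hp0.le
        have hG0 : 0 ≤ G x := by simp only [G]; positivity
        rw [abs_of_nonneg (mul_nonneg φ.nonneg hG0)]
        exact mul_le_of_le_one_left hG0 φ.le_one
      · rw [indicator_of_notMem hx]
        have : u x = 0 := by
          simp only [u]
          rw [hφout x (by simpa using hx), zero_mul]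
        rw [this]
        simp [hp0.ne']
  · let K : Set (E m) := Metric.closedBall 0 2 \ Metric.ball 0 1
    have hK : IsCompact K := (isCompact_closedBall 0 2).diff Metric.isOpen_ball
    have hK0 : K ⊆ {x | x ≠ 0} := by
      rintro x hx rfl
      simp [K] at hx
    have hc : ContinuousOn (fun x => |lap u x| ^ p) K :=
      (((lap_cont hu).mono hK0).abs).rpow_const fun x _ => Or.inr hp0.le
    have hi : IntegrableOn (fun x => |lap u x| ^ p) K := hc.integrableOn_compact hK
    refine hi.of_forall_sdiff_eq_zero hms ?_
    rintro x ⟨hx0, hxK⟩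
    have : lap u x = 0 := by
      by_cases h1 : x ∈ Metric.ball (0 : E m) 1
      · rw [lap_congr (huG x h1)]
        exact lap_G s hs x hx0
      · have h2 : x ∉ Metric.closedBall (0 : E m) 2 := fun h => hxK ⟨h, h1⟩
        have : u =ᶠ[𝓝 x] fun _ => 0 := by
          filter_upwards [Metric.isClosed_closedBall.isOpen_compl.mem_nhds h2] with y hy
          have : 2 < ‖y‖ := by simpa using hy
          simp only [u]
          rw [hφout y this.le, zero_mul]
        rw [lap_congr this]
        have hz : ∀ i : Fin m, pd (fun _ : E m => (0 : ℝ)) i = fun _ => 0 := by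
          intro i; ext y; simp [pd]
        simp [lap, pd2, hz]
    simp only [this]
    simp [hp0.ne']
  · intro h
    have hb : IntegrableOn (fun x => |gradNorm u x| ^ p) (Metric.ball (0 : E m) 1) :=
      (integrableOn_univ.1 (h.congr_set_ae (by
        filter_upwards [ae_ne hm] with x hx
        exact propext ⟨fun _ => hx, fun _ => trivial⟩))).integrableOn
    have hq : (0 : ℝ) < m - 2 := by linarith
    have hc : IntegrableOn (fun x : E m => ((m : ℝ) - 2) ^ p * ‖x‖ ^ ((1 - m : ℝ) * p))
        (Metric.ball (0 : E m) 1) := by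
      refine Integrable.congr hb ?_
      filter_upwards [ae_restrict_mem Metric.isOpen_ball.measurableSet,
        ae_restrict_of_ae (ae_ne hm)] with x hx hx0
      rw [gradNorm_congr (huG x hx), gradNorm_G hm s hs x hx0, abs_of_nonneg (by positivity),
        Real.mul_rpow hq.le (by positivity), Real.rpow_mul (norm_nonneg _)]
    have hd := hc.const_mul ((((m : ℝ) - 2) ^ p)⁻¹)
    have hne : ((m : ℝ) - 2) ^ p ≠ 0 := by positivity
    simp only [inv_mul_cancel_left₀ hne] at hd
    have := (rad_int m hm _ 1 one_pos).1 hd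
    nlinarith
end
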